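/- arXiv:math/0405131 — 3 statements merged into one kernel-verified Lean document; each statement's English description precedes it below -/
import Mathlib

section
/- The convolution ⋆ on c₀(F) is F-bilinear and satisfies α ⋆ β ∈ c₀(F) and ‖α ⋆ β‖ ≤ ‖α‖·‖β‖ for all α, β ∈ c₀(F) (hence ⋆ is continuous), so c₀(F) is a Banach algebra under ⋆; this algebra is non-associative (there exist α, β, γ ∈ c₀(F) with (α ⋆ β) ⋆ γ ≠ α ⋆ (β ⋆ γ)) and non-commutative (there exist α, β ∈ c₀(F) with α ⋆ β ≠ β ⋆ α). -/
open Filter Topology Pointwise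

/-- A tight `F`-valued measure on a topological space `G` in the sense of van Rooij's
non-Archimedean integration theory.  The data consists of the completion `Af(G,μ)` of the
algebra `Bco(G)` of clopen sets, the measure itself, the function `N_μ`, the class of
`μ`-integrable functions, the class of `Af(G,μ)`-measurable functions, the integral and the
total norm `‖μ‖` of the measure. -/
structure NAMeasure (G : Type*) [TopologicalSpace G] (F : Type*)
    [NontriviallyNormedField F] where
  /-- the completion `Af(G,μ)` of the algebra of clopen sets -/
  Af : Set (Set G)
  clopen_mem : ∀ A : Set G, IsClopen A → A ∈ Af
  /-- the `F`-valued measure -/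
  meas : Set G → F
  meas_add : ∀ A B, A ∈ Af → B ∈ Af → Disjoint A B → meas (A ∪ B) = meas A + meas B
  /-- the function `N_μ` -/
  N : G → ℝ
  N_nonneg : ∀ x, 0 ≤ N x
  /-- tightness: each set `{x : N_μ(x) ≥ ε}`, `ε > 0`, is compact -/
  tight : ∀ ε : ℝ, 0 < ε → IsCompact {x | ε ≤ N x}
  /-- the `μ`-integrable `F`-valued functions, i.e. the members of `L(G,μ,F)` -/
  Integrable : (G → F) → Prop
  /-- the `(Af(G,μ), Bco(F))`-measurable functions -/
  MeasurableFn : (G → F) → Prop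
  /-- the integral `f ↦ ∫_G f dμ` -/
  integral : (G → F) → F
  integral_add : ∀ f g, integral (f + g) = integral f + integral g
  integral_smul : ∀ (c : F) (f : G → F), integral (c • f) = c * integral f
  norm_integral_le : ∀ f, ‖integral f‖ ≤ ⨆ x, ‖f x‖ * N x
  meas_eq_integral_indicator : ∀ A ∈ Af, meas A = integral (A.indicator 1)
  /-- the norm `‖μ‖` of the measure -/
  totalNorm : ℝ

namespace NAMeasure

variable {G : Type*} [TopologicalSpace G] {F : Type*} [NontriviallyNormedField F]

/-- The norm `‖f‖ = sup_x ‖f x‖ N_μ(x)` of the space `L(G,μ,F)`. -/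
noncomputable def Lnorm (μ : NAMeasure G F) (f : G → F) : ℝ := ⨆ x, ‖f x‖ * μ.N x

/-- The norm `‖A‖_μ = sup_{x ∈ A} N_μ(x)` of a subset `A ⊆ G`. -/
noncomputable def setNorm (μ : NAMeasure G F) (A : Set G) : ℝ := ⨆ x ∈ A, μ.N x

/-- `A` is a `μ`-negligible subset of `G`. -/
def NullSet (μ : NAMeasure G F) (A : Set G) : Prop := μ.setNorm A = 0

/-- `μ` is a probability measure: `μ(G) = 1` and `‖G‖_μ = 1 = ‖μ‖`. -/
def IsProb (μ : NAMeasure G F) : Prop :=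
  μ.meas Set.univ = 1 ∧ μ.setNorm Set.univ = 1 ∧ μ.totalNorm = 1

end NAMeasure

/-- A pair `(H, G)` of topological groups: `H` is continuously and densely embedded in `G`,
the topology `τ_H` is finer than the one induced by `τ_G`, and there is an open base at the
identity of `H` whose members have compact closures in `G`. -/
structure GroupPair (H G : Type*) [Group H] [TopologicalSpace H]
    [Group G] [TopologicalSpace G] where
  /-- the embedding of `H` into `G` -/
  ι : H →* G
  inj : Function.Injective ι
  cont : Continuous ι
  dense : DenseRange ι
  compactBase : ∀ U ∈ 𝓝 (1 : H), ∃ V ∈ 𝓝 (1 : H), V ⊆ U ∧ IsCompact (closure (ι '' V))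

/-- `μ` is left quasi-invariant relative to the dense subgroup `H`: for every `φ ∈ H` the
shifted measure `μ_φ(A) = μ(φ⁻¹A)` is equivalent to `μ` (they have the same null sets). -/
def IsLeftQuasiInvariant {H G : Type*} [Group H] [TopologicalSpace H] [Group G]
    [TopologicalSpace G] {F : Type*} [NontriviallyNormedField F]
    (P : GroupPair H G) (μ : NAMeasure G F) : Prop :=
  ∀ (h : H) (A : Set G), μ.NullSet A ↔ μ.NullSet ((fun g => P.ι h * g) ⁻¹' A)

section LH

variable {H G : Type*} [Group H] [TopologicalSpace H] [Group G] [TopologicalSpace G]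
variable {F : Type*} [NontriviallyNormedField F]

/-- Membership in `L_H(G,μ,F)`: all left translates `f_h`, `h ∈ H`, are `μ`-integrable. -/
def MemLH (P : GroupPair H G) (μ : NAMeasure G F) (f : G → F) : Prop :=
  ∀ h : H, μ.Integrable fun g => f ((P.ι h)⁻¹ * g)

/-- The norm `‖f‖_{L_H(G,μ,F)} = sup_{h ∈ H} ‖f_h‖_{L(G,μ,F)}`. -/
noncomputable def LHnorm (P : GroupPair H G) (μ : NAMeasure G F) (f : G → F) : ℝ :=
  ⨆ h : H, μ.Lnorm fun g => f ((P.ι h)⁻¹ * g)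

/-- The convolution of measures, `(ν * μ)(A) = ∫_H μ_h(A) ν(dh)` with `μ_h(A) = μ(h⁻¹A)`. -/
noncomputable def convMeas (P : GroupPair H G) (ν : NAMeasure H F) (μ : NAMeasure G F) :
    Set G → F :=
  fun A => ν.integral fun h => μ.meas ((fun g => P.ι h * g) ⁻¹' A)

/-- The convolution of functions, `(q ∗̃ f)(g) = ∫_H f(hg) q(h) ν(dh)`. -/
noncomputable def convFun (P : GroupPair H G) (ν : NAMeasure H F) (q : H → F) (f : G → F) :
    G → F :=
  fun g => ν.integral fun h => f (P.ι h * g) * q h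

/-- An approximate unit relative to the probability measure `ν` on `H`: a sequence of
nonzero continuous functions with integral `1` whose supports shrink to the identity. -/
def IsApproxUnit (ν : NAMeasure H F) (ψ : ℕ → H → F) : Prop :=
  (∀ i, ψ i ≠ 0) ∧ (∀ i, Continuous (ψ i)) ∧ (∀ i, ν.integral (ψ i) = 1) ∧
    ∀ U ∈ 𝓝 (1 : H), ∃ i₀ : ℕ, ∀ i > i₀, Function.support (ψ i) ⊆ U

end LH


variable {F : Type*} [NontriviallyNormedField F] [IsUltrametricDist F] [CompleteSpace F]

/-- The set `c₀(F)` of sequences in `F` converging to zero. -/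
def c0Set (F : Type*) [NontriviallyNormedField F] : Set (ℕ → F) :=
  {α | Tendsto (fun i => ‖α i‖) atTop (𝓝 0)}

/-- The supremum norm `‖α‖ = sup_i |α^i|` on `c₀(F)`. -/
noncomputable def c0Norm (α : ℕ → F) : ℝ := ⨆ i : ℕ, ‖α i‖

/-- The convolution `(α ⋆ β)^i := α^{i+1} β^i` on `c₀(F)`. -/
def c0Conv (α β : ℕ → F) : ℕ → F := fun i => α (i + 1) * β i

theorem bddAbove_range_norm_of_mem_c0Set {K : Type*} [NontriviallyNormedField K] {α : ℕ → K}
    (hα : α ∈ c0Set K) : BddAbove (Set.range fun i => ‖α i‖) :=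
  Tendsto.bddAbove_range hα

theorem single_mem_c0Set {K : Type*} [NontriviallyNormedField K] (n : ℕ) (c : K) :
    Pi.single n c ∈ c0Set K := by
  refine tendsto_const_nhds.congr' ?_
  filter_upwards [eventually_gt_atTop n] with i hi
  simp [Pi.single_eq_of_ne hi.ne']

/-- **Definition 20 / Note 21.** The convolution `⋆` on `c₀(F)` is `F`-bilinear,
`α ⋆ β ∈ c₀(F)` with `‖α ⋆ β‖ ≤ ‖α‖ ‖β‖` (hence `⋆` is continuous and `c₀(F)` is a Banach
algebra under `⋆`), and this algebra is non-associative and non-commutative. -/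
theorem c0_convolution_banach_algebra :
    (∀ α β : ℕ → F, α ∈ c0Set F → β ∈ c0Set F →
      c0Conv α β ∈ c0Set F ∧ c0Norm (c0Conv α β) ≤ c0Norm α * c0Norm β) ∧
    (∀ α₁ α₂ β : ℕ → F, c0Conv (α₁ + α₂) β = c0Conv α₁ β + c0Conv α₂ β) ∧
    (∀ (c : F) (α β : ℕ → F), c0Conv (c • α) β = c • c0Conv α β) ∧
    (∀ α β₁ β₂ : ℕ → F, c0Conv α (β₁ + β₂) = c0Conv α β₁ + c0Conv α β₂) ∧
    (∀ (c : F) (α β : ℕ → F), c0Conv α (c • β) = c • c0Conv α β) ∧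
    (∃ α β γ : ℕ → F, α ∈ c0Set F ∧ β ∈ c0Set F ∧ γ ∈ c0Set F ∧
      c0Conv (c0Conv α β) γ ≠ c0Conv α (c0Conv β γ)) ∧
    (∃ α β : ℕ → F, α ∈ c0Set F ∧ β ∈ c0Set F ∧ c0Conv α β ≠ c0Conv β α) := by
  refine ⟨fun α β hα hβ => ⟨?_, ?_⟩, ?_, ?_, ?_, ?_, ?_, ?_⟩
  · have h := ((tendsto_add_atTop_iff_nat 1).2 hα).mul hβ
    rw [mul_zero] at h
    exact h.congr fun i => (norm_mul _ _).symm
  · refine ciSup_le fun i => ?_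
    rw [c0Conv, norm_mul]
    exact mul_le_mul (le_ciSup (bddAbove_range_norm_of_mem_c0Set hα) (i + 1))
      (le_ciSup (bddAbove_range_norm_of_mem_c0Set hβ) i) (norm_nonneg _)
      (Real.iSup_nonneg fun _ => norm_nonneg _)
  · intro α₁ α₂ β
    ext i
    simp [c0Conv, add_mul]
  · intro c α β
    ext i
    simp [c0Conv, mul_assoc]
  · intro α β₁ β₂
    ext i
    simp [c0Conv, mul_add]
  · intro c α β
    ext i
    simp [c0Conv, mul_left_comm]
  · refine ⟨Pi.single 2 1, Pi.single 1 1, Pi.single 0 1, single_mem_c0Set _ _,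
      single_mem_c0Set _ _, single_mem_c0Set _ _, fun h => ?_⟩
    simpa [c0Conv, Pi.single_apply] using congrFun h 0
  · refine ⟨Pi.single 1 1, Pi.single 0 1, single_mem_c0Set _ _, single_mem_c0Set _ _,
      fun h => ?_⟩
    simpa [c0Conv, Pi.single_apply] using congrFun h 0
end

section
/- For each i ∈ ℕ₀ the F-linear subspace J_i := {α ∈ c₀(F) : α^j = 0 for each j > i} is a two-sided ideal of the convolution algebra c₀(F): J_i ⋆ c₀(F) ⊆ J_i and c₀(F) ⋆ J_i = J_i; however J_i ⋆ c₀(F) ≠ J_i. -/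
open Filter Topology Pointwise

variable {F : Type*} [NontriviallyNormedField F] [IsUltrametricDist F] [CompleteSpace F]

/-- The two-sided ideal `J_i = {α ∈ c₀(F) : α^j = 0 for each j > i}`. -/
def c0J (F : Type*) [NontriviallyNormedField F] (i : ℕ) : Set (ℕ → F) :=
  {α | α ∈ c0Set F ∧ ∀ j > i, α j = 0}

theorem mem_c0Set_of_eventually_zero {F : Type*} [NontriviallyNormedField F] {α : ℕ → F}
    {n : ℕ} (h : ∀ j > n, α j = 0) : α ∈ c0Set F := by
  refine tendsto_const_nhds.congr' ?_
  filter_upwards [eventually_gt_atTop n] with j hj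
  rw [h j hj, norm_zero]

theorem mem_c0J_iff {F : Type*} [NontriviallyNormedField F] {α : ℕ → F} {i : ℕ} :
    α ∈ c0J F i ↔ ∀ j > i, α j = 0 :=
  ⟨fun h => h.2, fun h => ⟨mem_c0Set_of_eventually_zero h, h⟩⟩

/-- **Note 21 (ideals `J_i`).** Each `J_i` is an `F`-linear subspace of `c₀(F)` and a
two-sided ideal of the convolution algebra `c₀(F)`: `J_i ⋆ c₀(F) ⊆ J_i` and
`c₀(F) ⋆ J_i = J_i`; however `J_i ⋆ c₀(F) ≠ J_i`. -/
theorem c0J_two_sided_ideal (i : ℕ) :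
    (∀ α β : ℕ → F, α ∈ c0J F i → β ∈ c0J F i → α + β ∈ c0J F i) ∧
    (∀ (c : F) (α : ℕ → F), α ∈ c0J F i → c • α ∈ c0J F i) ∧
    Set.image2 c0Conv (c0J F i) (c0Set F) ⊆ c0J F i ∧
    Set.image2 c0Conv (c0Set F) (c0J F i) = c0J F i ∧
    Set.image2 c0Conv (c0J F i) (c0Set F) ≠ c0J F i := by
  refine ⟨fun α β hα hβ => ?_, fun c α hα => ?_, ?_, ?_, fun h => ?_⟩
  · rw [mem_c0J_iff] at *
    intro j hj
    simp [hα j hj, hβ j hj]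
  · rw [mem_c0J_iff] at *
    intro j hj
    simp [hα j hj]
  · rintro _ ⟨α, hα, β, -, rfl⟩
    rw [mem_c0J_iff] at *
    intro j hj
    simp [c0Conv, hα (j + 1) (by omega)]
  · apply Set.Subset.antisymm
    · rintro _ ⟨α, -, β, hβ, rfl⟩
      rw [mem_c0J_iff] at *
      intro j hj
      simp [c0Conv, hβ j hj]
    · intro β hβ
      refine ⟨fun j => if j ≤ i + 1 then 1 else 0,
        mem_c0Set_of_eventually_zero (n := i + 1) fun j hj => if_neg (by omega), β, hβ, ?_⟩
      funext j
      by_cases hj : j ≤ i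
      · simp [c0Conv, hj]
      · simp [c0Conv, hβ.2 j (by omega)]
  · have hmem : (Pi.single i 1 : ℕ → F) ∈ c0J F i :=
      mem_c0J_iff.2 fun j hj => Pi.single_eq_of_ne (by omega) _
    rw [← h] at hmem
    obtain ⟨α, hα, β, -, hαβ⟩ := hmem
    have hi := congrFun hαβ i
    simp [c0Conv, hα.2 (i + 1) (by omega)] at hi
end

section
/- For each i ∈ ℕ₀ the F-linear subspace K_i := {α ∈ c₀(F) : α^j = 0 for each j = 0,…,i} satisfies c₀(F) ⋆ K_i = K_i and K_i ⋆ c₀(F) = K_{i-1}, where K_{-1} := c₀(F); thus each K_i is a right ideal of the convolution algebra c₀(F) that is not a left ideal. -/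
open Filter Topology Pointwise

variable {F : Type*} [NontriviallyNormedField F] [IsUltrametricDist F] [CompleteSpace F]

/-- The right ideal `K_i = {α ∈ c₀(F) : α^j = 0 for each j = 0,…,i}`. -/
def c0K (F : Type*) [NontriviallyNormedField F] (i : ℕ) : Set (ℕ → F) :=
  {α | α ∈ c0Set F ∧ ∀ j ≤ i, α j = 0}

theorem mem_c0Set_iff_tendsto {E : Type*} [NontriviallyNormedField E] {α : ℕ → E} :
    α ∈ c0Set E ↔ Tendsto α atTop (𝓝 0) :=
  tendsto_zero_iff_norm_tendsto_zero.symm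

theorem exists_mul_eq_norm_le_sqrt {E : Type*} [NontriviallyNormedField E] {c : E}
    (hc : 1 < ‖c‖) (x : E) :
    ∃ a b : E, a * b = x ∧ ‖a‖ ≤ √‖x‖ ∧ ‖b‖ ≤ ‖c‖ * √‖x‖ := by
  rcases eq_or_ne x 0 with rfl | hx
  · exact ⟨0, 0, by simp⟩
  have hs : 0 < √‖x‖ := Real.sqrt_pos.2 (norm_pos_iff.2 hx)
  obtain ⟨n, hn, hn'⟩ := exists_mem_Ioc_zpow hs hc
  have hc0 : c ≠ 0 := norm_pos_iff.1 (zero_lt_one.trans hc)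
  refine ⟨x / c ^ (n + 1), c ^ (n + 1), div_mul_cancel₀ _ (zpow_ne_zero _ hc0), ?_, ?_⟩
  · rw [norm_div, norm_zpow, div_le_iff₀ (hs.trans_le hn')]
    calc ‖x‖ = √‖x‖ * √‖x‖ := (Real.mul_self_sqrt (norm_nonneg x)).symm
      _ ≤ √‖x‖ * ‖c‖ ^ (n + 1) := by gcongr
  · rw [norm_zpow, zpow_add_one₀ (norm_ne_zero_iff.2 hc0), mul_comm]
    gcongr

/-- Every null sequence is a product of two null sequences, both vanishing wherever it does. -/
theorem exists_mul_eq_of_mem_c0Set {E : Type*} [NontriviallyNormedField E] {γ : ℕ → E}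
    (hγ : γ ∈ c0Set E) :
    ∃ a ∈ c0Set E, ∃ b ∈ c0Set E, ∀ n, a n * b n = γ n ∧ (γ n = 0 → a n = 0 ∧ b n = 0) := by
  obtain ⟨c, hc⟩ := NormedField.exists_one_lt_norm E
  choose a b hab ha hb using fun n => exists_mul_eq_norm_le_sqrt hc (γ n)
  have hs : Tendsto (fun n => √‖γ n‖) atTop (𝓝 0) := by
    simpa using (show Tendsto (fun n => ‖γ n‖) atTop (𝓝 0) from hγ).sqrt
  refine ⟨a, squeeze_zero (fun _ => norm_nonneg _) ha hs,
    b, squeeze_zero (fun _ => norm_nonneg _) hb (by simpa using hs.const_mul ‖c‖),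
    fun n => ⟨hab n, fun h => ⟨?_, ?_⟩⟩⟩
  · simpa [h] using ha n
  · simpa [h] using hb n

theorem c0Conv_mem_c0Set {E : Type*} [NontriviallyNormedField E] {α β : ℕ → E}
    (hα : α ∈ c0Set E) (hβ : β ∈ c0Set E) :
    c0Conv α β ∈ c0Set E := by
  rw [mem_c0Set_iff_tendsto] at *
  have h := ((tendsto_add_atTop_iff_nat 1).2 hα).mul hβ
  rwa [mul_zero] at h

theorem exists_c0Conv_eq_of_mem_c0Set {E : Type*} [NontriviallyNormedField E] {γ : ℕ → E}
    (hγ : γ ∈ c0Set E) :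
    ∃ α ∈ c0K E 0, ∃ β ∈ c0Set E, c0Conv α β = γ ∧
      ∀ n, γ n = 0 → α (n + 1) = 0 ∧ β n = 0 := by
  obtain ⟨a, ha, b, hb, hab⟩ := exists_mul_eq_of_mem_c0Set hγ
  let α : ℕ → E := fun n => Nat.casesOn n 0 a
  refine ⟨α, ⟨?_, ?_⟩, b, hb, funext fun n => (hab n).1,
    fun n => (hab n).2⟩
  · rw [mem_c0Set_iff_tendsto] at ha ⊢
    exact (tendsto_add_atTop_iff_nat 1).1 ha
  · intro j hj
    obtain rfl := Nat.le_zero.1 hj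
    rfl

theorem image2_c0Conv_c0Set_c0K {E : Type*} [NontriviallyNormedField E] (i : ℕ) :
    Set.image2 c0Conv (c0Set E) (c0K E i) = c0K E i := by
  apply Set.Subset.antisymm
  · rintro _ ⟨α, hα, β, hβ, rfl⟩
    exact ⟨c0Conv_mem_c0Set hα hβ.1, fun j hj => by simp [c0Conv, hβ.2 j hj]⟩
  · intro γ hγ
    obtain ⟨α, hα, β, hβ, h, h0⟩ := exists_c0Conv_eq_of_mem_c0Set hγ.1
    exact ⟨α, hα.1, β, ⟨hβ, fun j hj => (h0 j (hγ.2 j hj)).2⟩, h⟩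

theorem image2_c0Conv_c0K_zero_c0Set {E : Type*} [NontriviallyNormedField E] :
    Set.image2 c0Conv (c0K E 0) (c0Set E) = c0Set E := by
  apply Set.Subset.antisymm
  · rintro _ ⟨α, hα, β, hβ, rfl⟩
    exact c0Conv_mem_c0Set hα.1 hβ
  · intro γ hγ
    obtain ⟨α, hα, β, hβ, h, -⟩ := exists_c0Conv_eq_of_mem_c0Set hγ
    exact ⟨α, hα, β, hβ, h⟩

theorem image2_c0Conv_c0K_succ_c0Set {E : Type*} [NontriviallyNormedField E] (i : ℕ) :
    Set.image2 c0Conv (c0K E (i + 1)) (c0Set E) = c0K E i := by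
  apply Set.Subset.antisymm
  · rintro _ ⟨α, hα, β, hβ, rfl⟩
    exact ⟨c0Conv_mem_c0Set hα.1 hβ,
      fun j hj => by simp [c0Conv, hα.2 (j + 1) (Nat.succ_le_succ hj)]⟩
  · intro γ hγ
    obtain ⟨α, hα, β, hβ, h, h0⟩ := exists_c0Conv_eq_of_mem_c0Set hγ.1
    refine ⟨α, ⟨hα.1, ?_⟩, β, hβ, h⟩
    rintro (_ | j) hj
    · exact hα.2 0 le_rfl
    · exact (h0 j (hγ.2 j (Nat.le_of_succ_le_succ hj))).1

theorem single_mem_c0Set_s18 {E : Type*} [NontriviallyNormedField E] (i : ℕ) (x : E) :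
    Pi.single i x ∈ c0Set E := by
  rw [mem_c0Set_iff_tendsto]
  refine tendsto_const_nhds.congr' ?_
  filter_upwards [eventually_gt_atTop i] with n hn
  simp [hn.ne']

theorem single_one_notMem_c0K {E : Type*} [NontriviallyNormedField E] (i : ℕ) :
    (Pi.single i 1 : ℕ → E) ∉ c0K E i :=
  fun h => by simpa using h.2 i le_rfl

/-- **Note 21 (ideals `K_i`).** Each `K_i` is an `F`-linear subspace of `c₀(F)` with
`c₀(F) ⋆ K_i = K_i` and `K_i ⋆ c₀(F) = K_{i-1}` (where `K_{-1} := c₀(F)`); thus each `K_i`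
is a right ideal of the convolution algebra `c₀(F)` which is not a left ideal
(`K_i ⋆ c₀(F) ≠ K_i`). -/
theorem c0K_right_ideal_not_left_ideal :
    (∀ i : ℕ, ∀ α β : ℕ → F, α ∈ c0K F i → β ∈ c0K F i → α + β ∈ c0K F i) ∧
    (∀ i : ℕ, ∀ (c : F) (α : ℕ → F), α ∈ c0K F i → c • α ∈ c0K F i) ∧
    (∀ i : ℕ, Set.image2 c0Conv (c0Set F) (c0K F i) = c0K F i) ∧
    Set.image2 c0Conv (c0K F 0) (c0Set F) = c0Set F ∧
    (∀ i : ℕ, Set.image2 c0Conv (c0K F (i + 1)) (c0Set F) = c0K F i) ∧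
    (∀ i : ℕ, Set.image2 c0Conv (c0K F i) (c0Set F) ≠ c0K F i) := by
  refine ⟨fun i α β hα hβ => ⟨?_, fun j hj => ?_⟩, fun i c α hα => ⟨?_, fun j hj => ?_⟩,
    image2_c0Conv_c0Set_c0K, image2_c0Conv_c0K_zero_c0Set, image2_c0Conv_c0K_succ_c0Set,
    fun i h => single_one_notMem_c0K (E := F) i ?_⟩
  · have h := (mem_c0Set_iff_tendsto.1 hα.1).add (mem_c0Set_iff_tendsto.1 hβ.1)
    rw [add_zero] at h
    exact mem_c0Set_iff_tendsto.2 h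
  · simp [hα.2 j hj, hβ.2 j hj]
  · have h := (mem_c0Set_iff_tendsto.1 hα.1).const_smul c
    rw [smul_zero] at h
    exact mem_c0Set_iff_tendsto.2 h
  · simp [hα.2 j hj]
  · rw [← h]
    cases i with
    | zero =>
      rw [image2_c0Conv_c0K_zero_c0Set]
      exact single_mem_c0Set_s18 0 1
    | succ i =>
      rw [image2_c0Conv_c0K_succ_c0Set]
      refine ⟨single_mem_c0Set_s18 _ 1, fun j hj => ?_⟩
      simp [(Nat.lt_succ_of_le hj).ne]
end
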